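/- arXiv:0710.0960 — 2 statements merged into one kernel-verified Lean document; each statement's English description precedes it below -/
import Mathlib

section
/- For every n ∈ ℕ the Laurent polynomials w_n are given by the closed formulae: w_{3n} = ∑_{k=0}^{n} binom(4n−2k, n+k)·binom(2n+2k, 3k)·t^{n−2k}/(3k+1); w_{3n+1} = ∑_{k=0}^{n} binom(4n+2−2k, n+k)·binom(2n+2k, 3k)·t^{n+1−2k}/(2n+1−k); w_{3n+2} = ∑_{k=0}^{n} binom(4n+2−2k, n+1+k)·binom(2n+2+2k, 3k+1)·t^{n−2k}/(3k+2). -/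
open LaurentPolynomial

/-- Every polynomial `φ` admits a power series `U` with `U = X * φ(U)`. -/
theorem exists_eq_X_mul_aeval {R : Type*} [CommRing R] (φ : Polynomial R) :
    ∃ U : PowerSeries R, U = PowerSeries.X * Polynomial.aeval U φ := by
  let step : PowerSeries R → PowerSeries R := fun V => PowerSeries.X * Polynomial.aeval V φ
  have hstep : ∀ (n : ℕ) (V W : PowerSeries R), PowerSeries.X ^ n ∣ V - W →
      PowerSeries.X ^ (n + 1) ∣ step V - step W := by
    intro n V W h
    have h1 : V - W ∣ Polynomial.aeval V φ - Polynomial.aeval W φ := by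
      simp only [Polynomial.aeval_def, ← Polynomial.eval_map]
      exact Polynomial.sub_dvd_eval_sub _ _ _
    simp only [step, ← mul_sub]
    rw [pow_succ']
    exact mul_dvd_mul_left _ (h.trans h1)
  let s : ℕ → PowerSeries R := fun n => step^[n] 0
  have hs : ∀ n, s (n + 1) = step (s n) := fun n => Function.iterate_succ_apply' _ _ _
  have hsucc : ∀ n, PowerSeries.X ^ n ∣ s (n + 1) - s n := by
    intro n
    induction n with
    | zero => simp
    | succ n ih => rw [hs (n + 1), hs n]; exact hstep n _ _ (by rw [← hs n]; exact ih)
  have hstable : ∀ n d, PowerSeries.X ^ n ∣ s (n + d) - s n := by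
    intro n d
    induction d with
    | zero => simp
    | succ d ih =>
      have h := dvd_add ((pow_dvd_pow _ (Nat.le_add_right n d)).trans (hsucc (n + d))) ih
      rwa [sub_add_sub_cancel] at h
  let U : PowerSeries R := PowerSeries.mk fun n => PowerSeries.coeff n (s (n + 1))
  have hU : ∀ n, PowerSeries.X ^ n ∣ U - s n := by
    intro n
    rw [PowerSeries.X_pow_dvd_iff]
    intro m hm
    obtain ⟨d, rfl⟩ := Nat.exists_eq_add_of_lt hm
    have h := (PowerSeries.X_pow_dvd_iff.mp (hstable (m + 1) d)) m (Nat.lt_succ_self m)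
    rw [show m + 1 + d = m + d + 1 by ring] at h
    rw [map_sub, sub_eq_zero] at h ⊢
    rw [h]
    simp [U]
  refine ⟨U, ?_⟩
  change U = step U
  rw [← sub_eq_zero]
  ext n
  have h := dvd_sub (hU (n + 1)) (hs n ▸ hstep n _ _ (hU n))
  rw [sub_sub_sub_cancel_right] at h
  simpa using (PowerSeries.X_pow_dvd_iff.mp h) n (Nat.lt_succ_self n)

/-- **Lagrange inversion** for the powers of the solution of `U = X * φ(U)`. -/
theorem lagrange_inversion_pow {R : Type*} [CommRing R] [IsDomain R] [CharZero R]
    (φ : Polynomial R) (U : PowerSeries R)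
    (hU : U = PowerSeries.X * Polynomial.aeval U φ) (n : ℕ) :
    ∀ m ≤ n, (n : R) * PowerSeries.coeff n (U ^ m) = m * (φ ^ n).coeff (n - m) := by
  induction n using Nat.strong_induction_on with
  | _ n ih =>
  intro m hm
  have hpow : ∀ j, U ^ j = PowerSeries.X ^ j * Polynomial.aeval U (φ ^ j) := by
    intro j
    rw [map_pow, ← mul_pow, ← hU]
  obtain ⟨d, rfl⟩ := Nat.exists_eq_add_of_le hm
  have haeval : PowerSeries.coeff (m + d) (U ^ m) =
      PowerSeries.coeff d (Polynomial.aeval U (φ ^ m)) := by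
    rw [hpow, add_comm m d, PowerSeries.coeff_X_pow_mul]
  have hvanish : ∀ e j, e < j → PowerSeries.coeff e (U ^ j) = 0 := by
    intro e j hj
    rw [hpow, PowerSeries.coeff_X_pow_mul', if_neg (by omega)]
  have hexp : ∀ (p : Polynomial R) (e : ℕ), PowerSeries.coeff e (Polynomial.aeval U p) =
      ∑ j ∈ Finset.range (e + 1), p.coeff j * PowerSeries.coeff e (U ^ j) := by
    intro p e
    rw [Polynomial.aeval_eq_sum_range' (n := max (p.natDegree + 1) (e + 1)) (by simp), map_sum]
    simp only [map_smul, smul_eq_mul]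
    refine (Finset.sum_subset (Finset.range_mono (le_max_right _ _)) ?_).symm
    intro j _ hj
    rw [hvanish e j (by simpa using hj), mul_zero]
  rcases Nat.eq_zero_or_pos m with rfl | hmpos
  · rcases Nat.eq_zero_or_pos d with rfl | hd
    · simp
    · simp [PowerSeries.coeff_one, hd.ne']
  rw [haeval, Nat.add_sub_cancel_left]
  rcases Nat.eq_zero_or_pos d with rfl | hd
  · rw [hexp]
    simp
  have hd0 : (d : R) ≠ 0 := by exact_mod_cast hd.ne'
  apply mul_left_cancel₀ hd0
  have key : (d : R) * PowerSeries.coeff d (Polynomial.aeval U (φ ^ m)) =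
      ((Polynomial.X * Polynomial.derivative (φ ^ m)) * φ ^ d).coeff d := by
    rw [hexp, Polynomial.coeff_mul, Finset.Nat.sum_antidiagonal_eq_sum_range_succ_mk,
      Finset.mul_sum]
    refine Finset.sum_congr rfl fun j hj => ?_
    have hjd : j ≤ d := by simpa [Nat.lt_succ_iff] using hj
    rw [mul_left_comm, ih d (by omega) j hjd]
    rcases j with _ | j
    · simp
    · rw [Polynomial.coeff_X_mul, Polynomial.coeff_derivative]
      push_cast
      ring
  have hder : ((m + d : ℕ) : Polynomial R) *
        ((Polynomial.X * Polynomial.derivative (φ ^ m)) * φ ^ d) =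
      (m : Polynomial R) * (Polynomial.X * Polynomial.derivative (φ ^ (m + d))) := by
    obtain ⟨m, rfl⟩ := Nat.exists_eq_succ_of_ne_zero hmpos.ne'
    rw [Polynomial.derivative_pow, Polynomial.derivative_pow,
      show m.succ + d - 1 = m + d by omega, Nat.succ_sub_one, pow_add]
    simp only [map_natCast]
    ring
  have hcoeff := congrArg (fun p => Polynomial.coeff p d) hder
  simp only [Polynomial.coeff_natCast_mul] at hcoeff
  rw [mul_left_comm, key, hcoeff]
  obtain ⟨d, rfl⟩ := Nat.exists_eq_succ_of_ne_zero hd.ne'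
  rw [Polynomial.coeff_X_mul, Polynomial.coeff_derivative]
  push_cast
  ring

/-- The specialization `a ↦ x * T`, `b ↦ x * T⁻¹` of a series in `ℚ[b]⟦a⟧`. -/
noncomputable def diagonalSeries (H : PowerSeries (Polynomial ℚ)) : PowerSeries ℚ[T;T⁻¹] :=
  PowerSeries.mk fun n => ∑ p ∈ Finset.HasAntidiagonal.antidiagonal n,
    LaurentPolynomial.C ((PowerSeries.coeff p.1 H).coeff p.2) * T ((p.1 : ℤ) - p.2)

theorem coeff_diagonalSeries (H : PowerSeries (Polynomial ℚ)) (n : ℕ) :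
    PowerSeries.coeff n (diagonalSeries H) = ∑ p ∈ Finset.HasAntidiagonal.antidiagonal n,
      LaurentPolynomial.C ((PowerSeries.coeff p.1 H).coeff p.2) * T ((p.1 : ℤ) - p.2) := by
  simp [diagonalSeries]

theorem diagonalSeries_add (H K : PowerSeries (Polynomial ℚ)) :
    diagonalSeries (H + K) = diagonalSeries H + diagonalSeries K := by
  ext1 n
  simp [coeff_diagonalSeries, add_mul, Finset.sum_add_distrib]

theorem diagonalSeries_one : diagonalSeries 1 = 1 := by
  ext1 n
  rw [coeff_diagonalSeries, PowerSeries.coeff_one]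
  split_ifs with h
  · subst h
    simp
  · refine Finset.sum_eq_zero fun p hp => ?_
    rw [Finset.HasAntidiagonal.mem_antidiagonal] at hp
    rw [PowerSeries.coeff_one]
    split_ifs with h1
    · rw [Polynomial.coeff_one, if_neg (by omega)]
      simp
    · simp

theorem diagonalSeries_mul (H K : PowerSeries (Polynomial ℚ)) :
    diagonalSeries (H * K) = diagonalSeries H * diagonalSeries K := by
  ext1 n
  simp only [coeff_diagonalSeries, PowerSeries.coeff_mul, Polynomial.finsetSum_coeff,
    Polynomial.coeff_mul, map_sum, Finset.sum_mul, Finset.mul_sum]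
  simp only [Finset.sum_sigma']
  refine Finset.sum_nbij'
    (fun x => ⟨(x.2.1.1 + x.2.2.1, x.2.1.2 + x.2.2.2), (x.2.1.2, x.2.2.2), (x.2.1.1, x.2.2.1)⟩)
    (fun x => ⟨(x.2.2.1 + x.2.1.1, x.2.2.2 + x.2.1.2), (x.2.2.1, x.2.1.1), (x.2.2.2, x.2.1.2)⟩)
    ?_ ?_ ?_ ?_ ?_
  · rintro ⟨⟨p, q⟩, ⟨⟨i, i'⟩, ⟨j, j'⟩⟩⟩ hx
    simp only [Finset.mem_sigma, Finset.HasAntidiagonal.mem_antidiagonal] at hx ⊢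
    obtain ⟨h, rfl, rfl⟩ := hx
    refine ⟨?_, trivial, trivial⟩
    omega
  · rintro ⟨⟨p, q⟩, ⟨⟨i, i'⟩, ⟨j, j'⟩⟩⟩ hx
    simp only [Finset.mem_sigma, Finset.HasAntidiagonal.mem_antidiagonal] at hx ⊢
    obtain ⟨h, rfl, rfl⟩ := hx
    refine ⟨?_, trivial, trivial⟩
    omega
  · rintro ⟨⟨p, q⟩, ⟨⟨i, i'⟩, ⟨j, j'⟩⟩⟩ hx
    simp only [Finset.mem_sigma, Finset.HasAntidiagonal.mem_antidiagonal] at hx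
    obtain ⟨-, rfl, rfl⟩ := hx
    rfl
  · rintro ⟨⟨p, q⟩, ⟨⟨i, i'⟩, ⟨j, j'⟩⟩⟩ hx
    simp only [Finset.mem_sigma, Finset.HasAntidiagonal.mem_antidiagonal] at hx
    obtain ⟨-, rfl, rfl⟩ := hx
    rfl
  · rintro ⟨⟨p, q⟩, ⟨⟨i, i'⟩, ⟨j, j'⟩⟩⟩ hx
    simp only [Finset.mem_sigma, Finset.HasAntidiagonal.mem_antidiagonal] at hx
    obtain ⟨-, rfl, rfl⟩ := hx
    dsimp only
    rw [map_mul, mul_mul_mul_comm, ← T_add]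
    congr 2
    push_cast
    ring

theorem diagonalSeries_X :
    diagonalSeries PowerSeries.X = PowerSeries.X * PowerSeries.C (T 1) := by
  ext1 n
  rw [coeff_diagonalSeries, PowerSeries.coeff_mul_C, PowerSeries.coeff_X]
  split_ifs with h
  · subst h
    simp [Finset.Nat.antidiagonal_succ, PowerSeries.coeff_X]
  · rw [zero_mul]
    refine Finset.sum_eq_zero fun p hp => ?_
    rw [Finset.HasAntidiagonal.mem_antidiagonal] at hp
    rw [PowerSeries.coeff_X]
    split_ifs with h1
    · rw [Polynomial.coeff_one, if_neg (by omega)]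
      simp
    · simp

theorem diagonalSeries_C_X :
    diagonalSeries (PowerSeries.C Polynomial.X) = PowerSeries.X * PowerSeries.C (T (-1)) := by
  ext1 n
  rw [coeff_diagonalSeries, PowerSeries.coeff_mul_C, PowerSeries.coeff_X]
  split_ifs with h
  · subst h
    simp [Finset.Nat.antidiagonal_succ, PowerSeries.coeff_C]
  · rw [zero_mul]
    refine Finset.sum_eq_zero fun p hp => ?_
    rw [Finset.HasAntidiagonal.mem_antidiagonal] at hp
    rw [PowerSeries.coeff_C]
    split_ifs with h1
    · rw [Polynomial.coeff_X, if_neg (by omega)]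
      simp
    · simp

/-- The coefficients of `F`, where `F = 1 + a * G ^ 2` and `G = 1 + b * F ^ 2`. -/
def mutualCoeff (i j : ℕ) : ℚ :=
  if i = 0 then if j = 0 then 1 else 0
  else ((2 * i).choose j * (2 * j).choose (i - 1) : ℚ) / i

theorem exists_mutual_series : ∃ F G : PowerSeries (Polynomial ℚ),
    F = 1 + PowerSeries.X * G ^ 2 ∧ G = 1 + PowerSeries.C Polynomial.X * F ^ 2 ∧
    ∀ i j, (PowerSeries.coeff i F).coeff j = mutualCoeff i j := by
  let φ : Polynomial (Polynomial ℚ) :=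
    (Polynomial.C Polynomial.X * (1 + Polynomial.X) ^ 2 + 1) ^ 2
  obtain ⟨U, hU⟩ := exists_eq_X_mul_aeval φ
  refine ⟨1 + U, 1 + PowerSeries.C Polynomial.X * (1 + U) ^ 2, ?_, rfl, ?_⟩
  · congr 1
    conv_lhs => rw [hU]
    simp only [φ, map_pow, map_add, map_mul, Polynomial.aeval_X, Polynomial.aeval_C, map_one]
    rw [add_comm (1 : PowerSeries (Polynomial ℚ)) (PowerSeries.C _ * _)]
    rfl
  intro i j
  rcases Nat.eq_zero_or_pos i with rfl | hi
  · have h0 : PowerSeries.coeff 0 U = 0 := by rw [hU]; simp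
    rw [map_add, h0, mutualCoeff, if_pos rfl]
    simp [Polynomial.coeff_one]
  have h := lagrange_inversion_pow φ U hU i 1 hi
  have hi0 : (i : ℚ) ≠ 0 := by exact_mod_cast hi.ne'
  rw [mutualCoeff, if_neg hi.ne', eq_div_iff hi0, map_add, PowerSeries.coeff_one, if_neg hi.ne',
    zero_add, mul_comm]
  have h2 := congrArg (fun p => Polynomial.coeff p j) h
  simp only [pow_one, Polynomial.coeff_natCast_mul, Nat.cast_one, one_mul] at h2
  rw [h2]
  simp only [φ, ← pow_mul]
  rw [add_pow]
  simp only [one_pow, mul_one, mul_pow, ← pow_mul, ← Polynomial.C_pow, Polynomial.finsetSum_coeff,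
    ← Polynomial.C_eq_natCast, mul_assoc, Polynomial.coeff_C_mul, Polynomial.coeff_mul_C]
  simp only [Polynomial.coeff_one_add_X_pow, Polynomial.coeff_X_pow_mul']
  have hterm : ∀ x, (if x ≤ j then (((2 * x).choose (i - 1) : Polynomial ℚ) *
      Polynomial.C ((2 * i).choose x : ℚ)).coeff (j - x) else 0) =
      if x = j then ((2 * i).choose j * (2 * j).choose (i - 1) : ℚ) else 0 := by
    intro x
    rw [← Polynomial.C_eq_natCast, ← map_mul, Polynomial.coeff_C]
    rcases lt_trichotomy x j with h | rfl | h
    · rw [if_pos h.le, if_neg (by omega), if_neg h.ne]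
    · simp [mul_comm]
    · rw [if_neg (by omega), if_neg h.ne']
  simp only [hterm, Finset.sum_ite_eq', Finset.mem_range]
  split_ifs with hj
  · rfl
  · rw [Nat.choose_eq_zero_of_lt (by omega)]
    simp

theorem mutualCoeff_eq_zero_of_lt_right {i j : ℕ} (h : 2 * i < j) : mutualCoeff i j = 0 := by
  unfold mutualCoeff
  split_ifs
  · omega
  · rfl
  · rw [Nat.choose_eq_zero_of_lt h]
    simp

theorem mutualCoeff_eq_zero_of_lt_left {i j : ℕ} (h : 2 * j + 1 < i) : mutualCoeff i j = 0 := by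
  rw [mutualCoeff, if_neg (by omega), Nat.choose_eq_zero_of_lt (show 2 * j < i - 1 by omega)]
  simp

theorem mutualCoeff_eq_div {i j : ℕ} (h : i ≤ 2 * j) :
    mutualCoeff i j = ((2 * i).choose j * (2 * j).choose (2 * j - i) : ℚ) / (2 * j - i + 1) := by
  have hne : (2 * j - i + 1 : ℚ) ≠ 0 := by
    have : (i : ℚ) ≤ 2 * j := by exact_mod_cast h
    linarith
  rw [Nat.choose_symm h]
  rcases i with _ | i
  · rcases j with _ | j <;> simp [mutualCoeff]
  · have hc := Nat.choose_succ_right_eq (2 * j) i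
    have hc' : ((2 * j).choose (i + 1) : ℚ) * (i + 1) = (2 * j).choose i * (2 * j - i) := by
      have := congrArg (Nat.cast : ℕ → ℚ) hc
      push_cast [Nat.cast_sub (show i ≤ 2 * j by omega)] at this
      exact this
    have hi : ((i + 1 : ℕ) : ℚ) ≠ 0 := by positivity
    rw [mutualCoeff, if_neg (by omega), div_eq_div_iff hi hne]
    push_cast
    linear_combination (-((2 * (i + 1)).choose j : ℚ)) * hc'

theorem eq_sum_mutualCoeff (w : ℕ → ℚ[T;T⁻¹])
    (hw0 : w 0 = 1)
    (hw : ∀ n : ℕ, w (n + 1) =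
      T 1 * ∑ k ∈ Finset.range (n + 1), invert (w k) * invert (w (n - k)))
    (n : ℕ) :
    w n = ∑ p ∈ Finset.HasAntidiagonal.antidiagonal n,
      LaurentPolynomial.C (mutualCoeff p.1 p.2) * T ((p.1 : ℤ) - p.2) := by
  obtain ⟨F, G, hF, hG, hcoeff⟩ := exists_mutual_series
  have hF' : diagonalSeries F =
      1 + PowerSeries.X * (PowerSeries.C (T 1) * (diagonalSeries G * diagonalSeries G)) := by
    conv_lhs => rw [hF]
    rw [diagonalSeries_add, diagonalSeries_one, sq, diagonalSeries_mul, diagonalSeries_mul,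
      diagonalSeries_X, mul_assoc]
  have hG' : diagonalSeries G =
      1 + PowerSeries.X * (PowerSeries.C (T (-1)) * (diagonalSeries F * diagonalSeries F)) := by
    conv_lhs => rw [hG]
    rw [diagonalSeries_add, diagonalSeries_one, sq, diagonalSeries_mul, diagonalSeries_mul,
      diagonalSeries_C_X, mul_assoc]
  have main : ∀ n, PowerSeries.coeff n (diagonalSeries F) = w n ∧
      PowerSeries.coeff n (diagonalSeries G) = invert (w n) := by
    intro n
    induction n using Nat.strong_induction_on with
    | _ n ih =>
    rcases n with _ | n
    · rw [hF', hG']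
      simp [hw0]
    · have hstep : ∀ (c : ℚ[T;T⁻¹]) (V : PowerSeries ℚ[T;T⁻¹]),
          PowerSeries.coeff (n + 1) (1 + PowerSeries.X * (PowerSeries.C c * (V * V))) =
            c * ∑ k ∈ Finset.range (n + 1),
              PowerSeries.coeff k V * PowerSeries.coeff (n - k) V := by
        intro c V
        rw [map_add, PowerSeries.coeff_succ_X_mul, PowerSeries.coeff_C_mul, PowerSeries.coeff_mul,
          Finset.Nat.sum_antidiagonal_eq_sum_range_succ_mk, PowerSeries.coeff_one,
          if_neg (Nat.succ_ne_zero n), zero_add]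
      constructor
      · rw [hF', hstep, hw n]
        refine congrArg (HMul.hMul (T 1)) (Finset.sum_congr rfl fun k hk => ?_)
        rw [Finset.mem_range] at hk
        rw [(ih k hk).2, (ih (n - k) (by omega)).2]
      · rw [hG', hstep, hw n, map_mul, invert_T, map_sum]
        refine congrArg (HMul.hMul (T (-1))) (Finset.sum_congr rfl fun k hk => ?_)
        rw [Finset.mem_range] at hk
        rw [(ih k hk).1, (ih (n - k) (by omega)).1, map_mul invert, involutive_invert (w k),
          involutive_invert (w (n - k))]
  rw [← (main n).1, coeff_diagonalSeries]
  simp only [hcoeff]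

/-- Only the terms `(i, j) = (p - k, q + k)` with `k ≤ n` contribute to the sum. -/
theorem sum_mutualCoeff_eq_sum_range {n p q : ℕ} (hnp : n ≤ p) (hlow : 2 * p < q + 3 * n + 3)
    (hhigh : 2 * q < p + 2) (f : ℕ → ℚ[T;T⁻¹])
    (hf : ∀ k ≤ n, LaurentPolynomial.C (mutualCoeff (p - k) (q + k)) *
      T (((p - k : ℕ) : ℤ) - (q + k : ℕ)) = f k) :
    ∑ p ∈ Finset.HasAntidiagonal.antidiagonal (p + q),
      LaurentPolynomial.C (mutualCoeff p.1 p.2) * T ((p.1 : ℤ) - p.2) =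
      ∑ k ∈ Finset.range (n + 1), f k := by
  symm
  refine Finset.sum_of_injOn (fun k => (p - k, q + k)) ?_ ?_ ?_ ?_
  · intro a _ b _ hab
    simpa using congrArg Prod.snd hab
  · intro k hk
    simp only [Finset.coe_range, Set.mem_Iio] at hk
    simp only [Finset.mem_coe, Finset.HasAntidiagonal.mem_antidiagonal]
    omega
  · rintro ⟨i, j⟩ hij hne
    simp only [Finset.HasAntidiagonal.mem_antidiagonal] at hij
    have h : 2 * i < j ∨ 2 * j + 1 < i := by
      by_contra! hcon
      apply hne
      refine ⟨j - q, ?_, ?_⟩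
      · simp only [Finset.coe_range, Set.mem_Iio]
        omega
      · simp only [Prod.mk.injEq]
        omega
    rcases h with h | h
    · rw [mutualCoeff_eq_zero_of_lt_right h, map_zero, zero_mul]
    · rw [mutualCoeff_eq_zero_of_lt_left h, map_zero, zero_mul]
  · intro k hk
    exact (hf k (by simpa [Nat.lt_succ_iff] using hk)).symm

/-- For the Laurent polynomials `w n` defined by `w 0 = 1` and
`w (n+1) (t) = t * ∑_{k=0}^{n} w k (t⁻¹) * w (n-k) (t⁻¹)`, one has the closed formulae
`w_{3n} = ∑_{k=0}^{n} C(4n−2k, n+k)·C(2n+2k, 3k)·t^{n−2k}/(3k+1)`,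
`w_{3n+1} = ∑_{k=0}^{n} C(4n+2−2k, n+k)·C(2n+2k, 3k)·t^{n+1−2k}/(2n+1−k)`,
`w_{3n+2} = ∑_{k=0}^{n} C(4n+2−2k, n+1+k)·C(2n+2+2k, 3k+1)·t^{n−2k}/(3k+2)`. -/
theorem stmt4 (w : ℕ → ℚ[T;T⁻¹])
    (hw0 : w 0 = 1)
    (hw : ∀ n : ℕ, w (n + 1) =
      T 1 * ∑ k ∈ Finset.range (n + 1), invert (w k) * invert (w (n - k)))
    (n : ℕ) :
    (w (3 * n) = ∑ k ∈ Finset.range (n + 1),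
        LaurentPolynomial.C ((((4 * n - 2 * k).choose (n + k) : ℚ)
          * ((2 * n + 2 * k).choose (3 * k) : ℚ)) / (3 * (k : ℚ) + 1))
          * T ((n : ℤ) - 2 * k)) ∧
    (w (3 * n + 1) = ∑ k ∈ Finset.range (n + 1),
        LaurentPolynomial.C ((((4 * n + 2 - 2 * k).choose (n + k) : ℚ)
          * ((2 * n + 2 * k).choose (3 * k) : ℚ)) / (2 * (n : ℚ) + 1 - (k : ℚ)))
          * T ((n : ℤ) + 1 - 2 * k)) ∧
    (w (3 * n + 2) = ∑ k ∈ Finset.range (n + 1),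
        LaurentPolynomial.C ((((4 * n + 2 - 2 * k).choose (n + 1 + k) : ℚ)
          * ((2 * n + 2 + 2 * k).choose (3 * k + 1) : ℚ)) / (3 * (k : ℚ) + 2))
          * T ((n : ℤ) - 2 * k)) := by
  have hsum := eq_sum_mutualCoeff w hw0 hw
  refine ⟨?_, ?_, ?_⟩
  · rw [hsum, show 3 * n = 2 * n + n by ring]
    refine sum_mutualCoeff_eq_sum_range (by omega) (by omega) (by omega) _ fun k hk => ?_
    rw [mutualCoeff_eq_div (by omega)]
    congr 2
    · rw [show 2 * (2 * n - k) = 4 * n - 2 * k by omega,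
        show 2 * (n + k) - (2 * n - k) = 3 * k by omega, show 2 * (n + k) = 2 * n + 2 * k by ring]
      push_cast [Nat.cast_sub (show k ≤ 2 * n by omega)]
      congr 1
      ring
    · omega
  · rw [hsum, show 3 * n + 1 = (2 * n + 1) + n by ring]
    refine sum_mutualCoeff_eq_sum_range (by omega) (by omega) (by omega) _ fun k hk => ?_
    rw [mutualCoeff, if_neg (by omega), ← Nat.choose_symm (show 2 * n + 1 - k - 1 ≤ 2 * (n + k) by omega)]
    congr 2
    · rw [show 2 * (2 * n + 1 - k) = 4 * n + 2 - 2 * k by omega,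
        show 2 * (n + k) - (2 * n + 1 - k - 1) = 3 * k by omega,
        show 2 * (n + k) = 2 * n + 2 * k by ring]
      push_cast [Nat.cast_sub (show k ≤ 2 * n + 1 by omega)]
      rfl
    · omega
  · rw [hsum, show 3 * n + 2 = (2 * n + 1) + (n + 1) by ring]
    refine sum_mutualCoeff_eq_sum_range (by omega) (by omega) (by omega) _ fun k hk => ?_
    rw [mutualCoeff_eq_div (by omega)]
    congr 2
    · rw [show 2 * (2 * n + 1 - k) = 4 * n + 2 - 2 * k by omega,
        show 2 * (n + 1 + k) - (2 * n + 1 - k) = 3 * k + 1 by omega,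
        show 2 * (n + 1 + k) = 2 * n + 2 + 2 * k by ring]
      push_cast [Nat.cast_sub (show k ≤ 2 * n + 1 by omega)]
      congr 1
      ring
    · omega
end

section
/- For every integer d with 2 ≤ d ≤ 6 and every n ∈ ℕ, the Laurent polynomials w_{d,n} are given by the closed formulae: w_{d,(d+1)n} = ∑_{k=0}^{(d−1)n} binom(d²n−dk, n+k)·binom(d(n+k), (d+1)k)·t^{(d−1)n−2k}/((d+1)k+1); w_{d,(d+1)n+1} = ∑_{k=0}^{(d−1)n} binom(d²n+d−dk, n+k)·binom(d(n+k), (d+1)k)·t^{(d−1)n+1−2k}/(dn+1−k); and for every j with 2 ≤ j ≤ d, w_{d,(d+1)n+j} = ∑_{k=0}^{(d−1)n+j−2} binom(d²n+d(j−1)−dk, n+1+k)·binom(dn+d+dk, (d+1)k+d−j+1)·t^{(d−1)n+j−2−2k}/((d+1)k+d−j+2). -/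
open LaurentPolynomial

/-- The coefficient of `u ^ a * v ^ b` in `B ^ r * A ^ s`, where `B = 1 + u * A ^ d` and
`A = 1 + v * B ^ d`. -/
def dissectionCoeff (d r s a b : ℕ) : ℚ :=
  (r + d * b).choose a * (s + d * a).choose b -
    match a, b with
    | a + 1, b + 1 => d ^ 2 * (r + d * (b + 1) - 1).choose a * (s + d * (a + 1) - 1).choose b
    | _, _ => 0

theorem dissectionCoeff_zero_left (d r s b : ℕ) :
    dissectionCoeff d r s 0 b = s.choose b := by
  simp [dissectionCoeff]

theorem dissectionCoeff_zero_right (d r s a : ℕ) :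
    dissectionCoeff d r s a 0 = r.choose a := by
  cases a <;> simp [dissectionCoeff]

theorem dissectionCoeff_succ_succ (d r s a b : ℕ) :
    dissectionCoeff d r s (a + 1) (b + 1) =
      (r + d * (b + 1)).choose (a + 1) * (s + d * (a + 1)).choose (b + 1) -
        d ^ 2 * (r + d * (b + 1) - 1).choose a * (s + d * (a + 1) - 1).choose b :=
  rfl

theorem dissectionCoeff_swap (d r s a b : ℕ) :
    dissectionCoeff d r s a b = dissectionCoeff d s r b a := by
  cases a <;> cases b <;> simp only [dissectionCoeff] <;> ring

theorem dissectionCoeff_succ_left {d : ℕ} (hd : 1 ≤ d) (r s a b : ℕ) :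
    dissectionCoeff d (r + 1) s (a + 1) b =
      dissectionCoeff d r s (a + 1) b + dissectionCoeff d r (s + d) a b := by
  obtain _ | b := b
  · simp only [dissectionCoeff_zero_right, Nat.choose_succ_succ]
    push_cast
    ring
  obtain ⟨m, hm⟩ : ∃ m, r + d * (b + 1) = m + 1 :=
    ⟨r + d * (b + 1) - 1, by have := Nat.mul_pos hd b.add_one_pos; omega⟩
  have hm' : r + 1 + d * (b + 1) = m + 1 + 1 := by omega
  obtain _ | a := a
  · simp only [dissectionCoeff_zero_left, dissectionCoeff_succ_succ, hm, hm']
    simp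
    ring
  · have hs : s + d + d * (a + 1) = s + d * (a + 1 + 1) := by ring
    simp only [dissectionCoeff_succ_succ, hm, hm', hs, Nat.add_sub_cancel,
      Nat.choose_succ_succ (m + 1) (a + 1), Nat.choose_succ_succ m a]
    push_cast
    ring

theorem dissectionCoeff_succ_right {d : ℕ} (hd : 1 ≤ d) (r s a b : ℕ) :
    dissectionCoeff d r (s + 1) a (b + 1) =
      dissectionCoeff d r s a (b + 1) + dissectionCoeff d (r + d) s a b := by
  simp only [dissectionCoeff_swap d _ _ a, dissectionCoeff_succ_left hd]

theorem dissectionCoeff_zero_zero {d : ℕ} (hd : 1 ≤ d) (a b : ℕ) (hab : a + b ≠ 0) :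
    dissectionCoeff d 0 0 a b = 0 := by
  obtain _ | a := a
  · obtain _ | b := b
    · simp at hab
    · simp [dissectionCoeff_zero_left]
  obtain _ | b := b
  · simp [dissectionCoeff_zero_right]
  obtain ⟨p, hp⟩ : ∃ p, d * (b + 1) = p + 1 :=
    ⟨d * (b + 1) - 1, by have := Nat.mul_pos hd b.add_one_pos; omega⟩
  obtain ⟨q, hq⟩ : ∃ q, d * (a + 1) = q + 1 :=
    ⟨d * (a + 1) - 1, by have := Nat.mul_pos hd a.add_one_pos; omega⟩
  have hp' := Nat.add_one_mul_choose_eq p a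
  have hq' := Nat.add_one_mul_choose_eq q b
  simp only [dissectionCoeff_succ_succ, hp, hq, Nat.add_sub_cancel, zero_add]
  have ha : ((a : ℚ) + 1) ≠ 0 := by positivity
  have hb : ((b : ℚ) + 1) ≠ 0 := by positivity
  qify at hp hq hp' hq'
  refine mul_left_cancel₀ (mul_ne_zero ha hb) ?_
  linear_combination (-(q + 1 : ℚ) * q.choose b) * hp'
    - ((p + 1).choose (a + 1) * (a + 1) : ℚ) * hq'
    + (-d * (b + 1) * (p.choose a) * q.choose b : ℚ) * hq
    + (-(p.choose a) * q.choose b * (q + 1) : ℚ) * hp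

theorem Nat.cast_choose_succ_mul (n k : ℕ) :
    (n.choose (k + 1) : ℚ) * (k + 1) = n.choose k * (n - k) := by
  have h := Nat.add_one_mul_choose_eq n k
  rw [Nat.choose_succ_succ] at h
  qify at h
  linear_combination -h

theorem succ_mul_dissectionCoeff_one_zero {d : ℕ} (hd : 1 ≤ d) (a b : ℕ) :
    ((a : ℚ) + 1) * dissectionCoeff d 1 0 (a + 1) b =
      (d * (a + 1)).choose b * (d * b).choose a := by
  obtain _ | b := b
  · obtain _ | a := a <;> simp [dissectionCoeff_zero_right, Nat.choose_eq_zero_of_lt]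
  obtain ⟨q, hq⟩ : ∃ q, d * (a + 1) = q + 1 :=
    ⟨d * (a + 1) - 1, by have := Nat.mul_pos hd a.add_one_pos; omega⟩
  have hx := Nat.cast_choose_succ_mul (d * (b + 1)) a
  have hy := Nat.add_one_mul_choose_eq q b
  simp only [dissectionCoeff_succ_succ, zero_add, hq, add_comm 1 (d * (b + 1)),
    Nat.add_sub_cancel, Nat.choose_succ_succ (d * (b + 1)) a]
  qify at hq hy hx
  push_cast
  linear_combination ((q + 1).choose (b + 1) : ℚ) * hx
    - (d * (d * (b + 1)).choose a : ℚ) * hy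
    - (d * (d * (b + 1)).choose a * q.choose b : ℚ) * hq

theorem mul_dissectionCoeff_one_zero {d : ℕ} (hd : 1 ≤ d) (a b : ℕ) :
    ((d : ℚ) * b + 1 - a) * dissectionCoeff d 1 0 a b =
      (d * a).choose b * (d * b).choose a := by
  obtain _ | a := a
  · obtain _ | b := b <;> simp [dissectionCoeff_zero_left]
  have ha : ((a : ℚ) + 1) ≠ 0 := by positivity
  have hx := Nat.cast_choose_succ_mul (d * b) a
  refine mul_left_cancel₀ ha ?_
  push_cast at hx ⊢
  linear_combination ((d : ℚ) * b - a) * succ_mul_dissectionCoeff_one_zero hd a b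
    - ((d * (a + 1)).choose b : ℚ) * hx

theorem dissectionCoeff_one_zero_eq_div {d a b : ℕ} (hd : 1 ≤ d) {c : ℚ} (hc : c ≠ 0)
    (h : c = d * b + 1 - a) :
    dissectionCoeff d 1 0 a b = ((d * a).choose b * (d * b).choose a) / c := by
  rw [eq_div_iff hc, ← mul_dissectionCoeff_one_zero hd, h, mul_comm]

theorem dissectionCoeff_one_zero_eq_zero {d a b : ℕ} (hd : 1 ≤ d)
    (h : d * b + 1 < a ∨ d * a < b) : dissectionCoeff d 1 0 a b = 0 := by
  have hne : (d : ℚ) * b + 1 - a ≠ 0 := by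
    rw [sub_ne_zero]
    norm_cast
    rcases h with h | h
    · exact h.ne
    · nlinarith
  rw [dissectionCoeff_one_zero_eq_div hd hne rfl]
  rcases h with h | h
  · rw [Nat.choose_eq_zero_of_lt (by omega : d * b < a)]
    simp
  · rw [Nat.choose_eq_zero_of_lt h]
    simp

/-- The coefficient of `x ^ n` in `B ^ r * A ^ s`, where `B = 1 + x * T * A ^ d` and
`A = 1 + x * T⁻¹ * B ^ d`. -/
noncomputable def dissectionSum (d r s n : ℕ) : ℚ[T;T⁻¹] :=
  ∑ p ∈ Finset.HasAntidiagonal.antidiagonal n,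
    LaurentPolynomial.C (dissectionCoeff d r s p.1 p.2) * T ((p.1 : ℤ) - p.2)

theorem dissectionSum_zero (d r s : ℕ) : dissectionSum d r s 0 = 1 := by
  simp [dissectionSum, dissectionCoeff_zero_left]

theorem dissectionSum_zero_zero_succ {d : ℕ} (hd : 1 ≤ d) (n : ℕ) :
    dissectionSum d 0 0 (n + 1) = 0 := by
  refine Finset.sum_eq_zero fun p hp => ?_
  rw [Finset.HasAntidiagonal.mem_antidiagonal] at hp
  rw [dissectionCoeff_zero_zero hd _ _ (by omega)]
  simp

theorem dissectionSum_succ_left {d : ℕ} (hd : 1 ≤ d) (r s n : ℕ) :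
    dissectionSum d (r + 1) s (n + 1) =
      dissectionSum d r s (n + 1) + T 1 * dissectionSum d r (s + d) n := by
  simp only [dissectionSum, Finset.Nat.sum_antidiagonal_succ, dissectionCoeff_zero_left,
    dissectionCoeff_succ_left hd, map_add, add_mul, Finset.sum_add_distrib, Finset.mul_sum,
    add_assoc]
  congr 2
  refine Finset.sum_congr rfl fun p _ => ?_
  rw [mul_left_comm, ← T_add]
  congr 2
  push_cast
  ring

theorem dissectionSum_succ_right {d : ℕ} (hd : 1 ≤ d) (r s n : ℕ) :
    dissectionSum d r (s + 1) (n + 1) =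
      dissectionSum d r s (n + 1) + T (-1) * dissectionSum d (r + d) s n := by
  simp only [dissectionSum, Finset.Nat.sum_antidiagonal_succ', dissectionCoeff_zero_right,
    dissectionCoeff_succ_right hd, map_add, add_mul, Finset.sum_add_distrib, Finset.mul_sum,
    add_assoc]
  congr 2
  refine Finset.sum_congr rfl fun p _ => ?_
  rw [mul_left_comm, ← T_add]
  congr 2
  push_cast
  ring

theorem coeff_pow_mul_pow_eq_dissectionSum {d : ℕ} (hd : 1 ≤ d) {A B : PowerSeries ℚ[T;T⁻¹]}
    (hB : B = 1 + PowerSeries.X * (PowerSeries.C (T 1) * A ^ d))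
    (hA : A = 1 + PowerSeries.X * (PowerSeries.C (T (-1)) * B ^ d)) (n r s : ℕ) :
    PowerSeries.coeff n (B ^ r * A ^ s) = dissectionSum d r s n := by
  induction n generalizing r s with
  | zero =>
    have hB0 : PowerSeries.constantCoeff B = 1 := by rw [hB]; simp
    have hA0 : PowerSeries.constantCoeff A = 1 := by rw [hA]; simp
    simp [dissectionSum_zero, hB0, hA0]
  | succ n ih =>
    induction r with
    | zero =>
      induction s with
      | zero => simp [dissectionSum_zero_zero_succ hd, PowerSeries.coeff_one]
      | succ s ihs =>
        have h : B ^ 0 * A ^ (s + 1) = B ^ 0 * A ^ s +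
            PowerSeries.X * (PowerSeries.C (T (-1)) * (B ^ (0 + d) * A ^ s)) := by
          rw [pow_succ]
          nth_rewrite 2 [hA]
          ring
        rw [h, map_add, ihs, PowerSeries.coeff_succ_X_mul, PowerSeries.coeff_C_mul, ih,
          dissectionSum_succ_right hd]
    | succ r ihr =>
      have h : B ^ (r + 1) * A ^ s = B ^ r * A ^ s +
          PowerSeries.X * (PowerSeries.C (T 1) * (B ^ r * A ^ (s + d))) := by
        rw [pow_succ]
        nth_rewrite 2 [hB]
        ring
      rw [h, map_add, ihr, PowerSeries.coeff_succ_X_mul, PowerSeries.coeff_C_mul, ih,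
        dissectionSum_succ_left hd]

theorem PowerSeries.coeff_pow_eq_sum_antidiagonalTuple {R : Type*} [CommSemiring R]
    (f : PowerSeries R) (d n : ℕ) :
    PowerSeries.coeff n (f ^ d) =
      ∑ k ∈ Finset.Nat.antidiagonalTuple d n, ∏ i : Fin d, PowerSeries.coeff (k i) f := by
  have h : f ^ d = ∏ _i : Fin d, f := by simp
  rw [h, PowerSeries.coeff_prod]
  refine Finset.sum_bij' (fun l _ => ⇑l) (fun k _ => Finsupp.equivFunOnFinite.symm k)
    ?_ ?_ ?_ ?_ ?_
  · intro l hl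
    simpa [Finset.mem_finsuppAntidiag, Finset.Nat.mem_antidiagonalTuple] using hl
  · intro k hk
    simpa [Finset.mem_finsuppAntidiag, Finset.Nat.mem_antidiagonalTuple] using hk
  · intro l _
    ext
    simp
  · intro k _
    simp
  · intro l _
    rfl

theorem eq_dissectionSum {d : ℕ} (hd : 1 ≤ d) {w : ℕ → ℚ[T;T⁻¹]} (hw0 : w 0 = 1)
    (hw : ∀ n : ℕ, w (n + 1) =
      T 1 * ∑ k ∈ Finset.Nat.antidiagonalTuple d n, ∏ i : Fin d, invert (w (k i))) (n : ℕ) :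
    w n = dissectionSum d 1 0 n := by
  have h := coeff_pow_mul_pow_eq_dissectionSum (B := PowerSeries.mk w)
    (A := PowerSeries.mk fun n => invert (w n)) hd ?_ ?_ n 1 0
  · simpa using h
  · ext1 n
    obtain _ | n := n
    · simp [hw0]
    · simp [hw, PowerSeries.coeff_succ_X_mul, PowerSeries.coeff_one,
        PowerSeries.coeff_pow_eq_sum_antidiagonalTuple]
  · ext1 n
    obtain _ | n := n
    · simp [hw0]
    · simp [hw, PowerSeries.coeff_succ_X_mul, PowerSeries.coeff_one,
        PowerSeries.coeff_pow_eq_sum_antidiagonalTuple, involutive_invert _]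

theorem dissectionSum_one_zero_eq_sum_range {d N m K : ℕ} (hd : 1 ≤ d) (hK : m + K ≤ N + 1)
    (hlo : ∀ b < m, d * b + 1 < N - b) (hhi : ∀ b, m + K ≤ b → b ≤ N → d * (N - b) < b) :
    dissectionSum d 1 0 N = ∑ k ∈ Finset.range K,
      LaurentPolynomial.C (dissectionCoeff d 1 0 (N - (m + k)) (m + k)) *
        T ((N : ℤ) - 2 * (m + k)) := by
  have h : dissectionSum d 1 0 N = ∑ b ∈ Finset.range (N + 1),
      LaurentPolynomial.C (dissectionCoeff d 1 0 (N - b) b) * T ((N : ℤ) - 2 * b) := by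
    rw [dissectionSum, ← Finset.Nat.sum_antidiagonal_swap,
      Finset.Nat.sum_antidiagonal_eq_sum_range_succ_mk]
    refine Finset.sum_congr rfl fun b hb => ?_
    have : b ≤ N := Finset.mem_range_succ_iff.mp hb
    simp only [Prod.fst_swap, Prod.snd_swap]
    congr 2
    omega
  have hsub : Finset.Ico m (m + K) ⊆ Finset.range (N + 1) := fun b hb => by
    rw [Finset.mem_Ico] at hb
    rw [Finset.mem_range]
    omega
  rw [h, ← Finset.sum_subset hsub, Finset.sum_Ico_eq_sum_range, Nat.add_sub_cancel_left]
  · simp only [Nat.cast_add]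
  · intro b hb hb'
    rw [Finset.mem_range] at hb
    rw [Finset.mem_Ico] at hb'
    rw [dissectionCoeff_one_zero_eq_zero hd, map_zero, zero_mul]
    by_cases hbm : b < m
    · exact Or.inl (hlo b hbm)
    · exact Or.inr (hhi b (by omega) (by omega))

/-- For `2 ≤ d ≤ 6` and the Laurent polynomials `w_{d,n}` defined by
`w_{d,0} = 1` and `w_{d,n+1}(t) = t·∑_{k₁+⋯+k_d = n} ∏ᵢ w_{d,kᵢ}(t⁻¹)`, one has the
closed formulae
`w_{d,(d+1)n}   = ∑_{k=0}^{(d−1)n} C(d²n−dk, n+k)·C(d(n+k), (d+1)k)·t^{(d−1)n−2k}/((d+1)k+1)`,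
`w_{d,(d+1)n+1} = ∑_{k=0}^{(d−1)n} C(d²n+d−dk, n+k)·C(d(n+k), (d+1)k)·t^{(d−1)n+1−2k}/(dn+1−k)`,
and for `2 ≤ j ≤ d`:
`w_{d,(d+1)n+j} = ∑_{k=0}^{(d−1)n+j−2} C(d²n+d(j−1)−dk, n+1+k)·C(dn+d+dk, (d+1)k+d−j+1)·
t^{(d−1)n+j−2−2k}/((d+1)k+d−j+2)`. -/
theorem stmt17 (d : ℕ) (hd2 : 2 ≤ d) (hd6 : d ≤ 6) (w : ℕ → ℚ[T;T⁻¹])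
    (hw0 : w 0 = 1)
    (hw : ∀ n : ℕ, w (n + 1) =
      T 1 * ∑ k ∈ Finset.Nat.antidiagonalTuple d n, ∏ i : Fin d, invert (w (k i)))
    (n : ℕ) :
    (w ((d + 1) * n) = ∑ k ∈ Finset.range ((d - 1) * n + 1),
        LaurentPolynomial.C ((((d ^ 2 * n - d * k).choose (n + k) : ℚ)
          * ((d * (n + k)).choose ((d + 1) * k) : ℚ)) / (((d : ℚ) + 1) * k + 1))
          * T (((d : ℤ) - 1) * n - 2 * k)) ∧
    (w ((d + 1) * n + 1) = ∑ k ∈ Finset.range ((d - 1) * n + 1),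
        LaurentPolynomial.C ((((d ^ 2 * n + d - d * k).choose (n + k) : ℚ)
          * ((d * (n + k)).choose ((d + 1) * k) : ℚ)) / ((d : ℚ) * n + 1 - k))
          * T (((d : ℤ) - 1) * n + 1 - 2 * k)) ∧
    (∀ j : ℕ, 2 ≤ j → j ≤ d →
      w ((d + 1) * n + j) = ∑ k ∈ Finset.range ((d - 1) * n + j - 2 + 1),
        LaurentPolynomial.C ((((d ^ 2 * n + d * (j - 1) - d * k).choose (n + 1 + k) : ℚ)
          * ((d * n + d + d * k).choose ((d + 1) * k + d - j + 1) : ℚ))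
          / (((d : ℚ) + 1) * k + d - j + 2))
          * T (((d : ℤ) - 1) * n + j - 2 - 2 * k)) := by
  obtain ⟨e, rfl⟩ : ∃ e, d = e + 1 := ⟨d - 1, by omega⟩
  have hd : 1 ≤ e + 1 := by omega
  simp only [eq_dissectionSum hd hw0 hw, Nat.add_sub_cancel]
  refine ⟨?_, ?_, fun j hj2 hjd => ?_⟩
  · rw [dissectionSum_one_zero_eq_sum_range (m := n) (K := e * n + 1) hd (by nlinarith)
      (fun b hb => by
        have : b + ((e + 1 + 1) * n - b) = (e + 1 + 1) * n := Nat.add_sub_cancel' (by nlinarith)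
        nlinarith)
      (fun b hb hb' => by
        have : b + ((e + 1 + 1) * n - b) = (e + 1 + 1) * n := Nat.add_sub_cancel' hb'
        nlinarith)]
    refine Finset.sum_congr rfl fun k hk => ?_
    rw [Finset.mem_range_succ_iff] at hk
    obtain ⟨a, ha⟩ : ∃ a, (e + 1) * n = k + a := Nat.exists_eq_add_of_le (by nlinarith)
    have hN : (e + 1 + 1) * n - (n + k) = a := by
      rw [Nat.sub_eq_iff_eq_add (by nlinarith)]; linarith
    have h1 : (e + 1) ^ 2 * n - (e + 1) * k = (e + 1) * a := by
      rw [pow_two, mul_assoc, ha, mul_add, Nat.add_sub_cancel_left]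
    have h2 : (e + 1) * (n + k) = a + (e + 1 + 1) * k := by linarith
    rw [hN, dissectionCoeff_one_zero_eq_div hd
      (c := ((e + 1 : ℕ) + 1 : ℚ) * k + 1) (by positivity), h1, h2,
      Nat.choose_symm_add]
    · congr 2
      push_cast
      ring
    · qify at h2
      push_cast
      linarith
  · rw [dissectionSum_one_zero_eq_sum_range (m := n) (K := e * n + 1) hd (by nlinarith)
      (fun b hb => by
        have : b + ((e + 1 + 1) * n + 1 - b) = (e + 1 + 1) * n + 1 :=
          Nat.add_sub_cancel' (by nlinarith)
        nlinarith)
      (fun b hb hb' => by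
        have : b + ((e + 1 + 1) * n + 1 - b) = (e + 1 + 1) * n + 1 := Nat.add_sub_cancel' hb'
        nlinarith)]
    refine Finset.sum_congr rfl fun k hk => ?_
    rw [Finset.mem_range_succ_iff] at hk
    obtain ⟨a, ha⟩ : ∃ a, (e + 1) * n = k + a := Nat.exists_eq_add_of_le (by nlinarith)
    have hN : (e + 1 + 1) * n + 1 - (n + k) = a + 1 := by
      rw [Nat.sub_eq_iff_eq_add (by nlinarith)]; linarith
    have h1 : (e + 1) ^ 2 * n + (e + 1) - (e + 1) * k = (e + 1) * (a + 1) := by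
      rw [Nat.sub_eq_iff_eq_add (by nlinarith)]; nlinarith
    have h2 : (e + 1) * (n + k) = a + (e + 1 + 1) * k := by linarith
    have hc : ((e + 1 : ℕ) : ℚ) * n + 1 - k = a + 1 := by
      qify at ha
      push_cast
      linarith
    rw [hN, hc, h1, eq_div_of_mul_eq (by positivity)
      ((mul_comm _ _).trans (succ_mul_dissectionCoeff_one_zero hd a (n + k))), h2,
      Nat.choose_symm_add]
    congr 2
    push_cast
    ring
  · obtain ⟨i, rfl⟩ : ∃ i, j = i + 2 := ⟨j - 2, by omega⟩
    obtain ⟨l, rfl⟩ : ∃ l, e = i + 1 + l := Nat.exists_eq_add_of_le (by omega)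
    rw [show (i + 1 + l) * n + (i + 2) - 2 = (i + 1 + l) * n + i by omega,
      dissectionSum_one_zero_eq_sum_range (m := n + 1) (K := (i + 1 + l) * n + i + 1) hd
      (by nlinarith)
      (fun b hb => by
        have : b + ((i + 1 + l + 1 + 1) * n + (i + 2) - b) = (i + 1 + l + 1 + 1) * n + (i + 2) :=
          Nat.add_sub_cancel' (by nlinarith)
        nlinarith)
      (fun b hb hb' => by
        have : b + ((i + 1 + l + 1 + 1) * n + (i + 2) - b) = (i + 1 + l + 1 + 1) * n + (i + 2) :=
          Nat.add_sub_cancel' hb'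
        nlinarith)]
    refine Finset.sum_congr rfl fun k hk => ?_
    rw [Finset.mem_range_succ_iff] at hk
    obtain ⟨a, ha⟩ : ∃ a, (i + 1 + l + 1) * n + (i + 1) = k + a :=
      Nat.exists_eq_add_of_le (by nlinarith)
    have hN : (i + 1 + l + 1 + 1) * n + (i + 2) - (n + 1 + k) = a := by
      rw [Nat.sub_eq_iff_eq_add (by nlinarith)]; linarith
    have h1 : (i + 1 + l + 1) ^ 2 * n + (i + 1 + l + 1) * (i + 2 - 1) - (i + 1 + l + 1) * k =
        (i + 1 + l + 1) * a := by
      rw [pow_two, mul_assoc, ← mul_add, Nat.add_sub_assoc (by omega), ha, mul_add,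
        Nat.add_sub_cancel_left]
    have h2 : (i + 1 + l + 1) * (n + 1 + k) = a + ((i + 1 + l + 1 + 1) * k + (l + 1)) := by
      linarith
    have h3 : (i + 1 + l + 1) * n + (i + 1 + l + 1) + (i + 1 + l + 1) * k =
        a + ((i + 1 + l + 1 + 1) * k + (l + 1)) := by
      linarith
    have h4 : (i + 1 + l + 1 + 1) * k + (i + 1 + l + 1) - (i + 2) + 1 =
        (i + 1 + l + 1 + 1) * k + (l + 1) := by
      omega
    have hc : ((i + 1 + l + 1 : ℕ) + 1 : ℚ) * k + (i + 1 + l + 1 : ℕ) - (i + 2 : ℕ) + 2 =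
        ((i + 1 + l + 1 : ℕ) + 1 : ℚ) * k + l + 2 := by
      push_cast
      ring
    rw [hN, hc, dissectionCoeff_one_zero_eq_div hd
      (c := ((i + 1 + l + 1 : ℕ) + 1 : ℚ) * k + l + 2) (by positivity), h1, h2, h3, h4,
      Nat.choose_symm_add]
    · congr 2
      push_cast
      ring
    · qify at h2
      push_cast
      linarith
end
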